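/- Let R = (ℂ²)^{⊗m} be a register of qubits containing two distinguished qubits labelled A and B, let H_else be Hermitian on R, and let P_A and P_B be Hermitian operators acting on qubit A and on qubit B respectively. Let n ≥ 2, fix i ≠ j in {1,…,n}, and assume Γλ + 1 > 5n (so that C ≥ 1/n > 0). On R⊗(ℂ²)^{⊗n} define d_k := ⟨W_n| X_k G X_k |W_n⟩ for k ∈ {i,j}, C := ⟨W_n|X_i G X_j|W_n⟩ + ⟨W_n|X_j G X_i|W_n⟩, H₁ := H_else + (1/C)·(d_i·P_A² + d_j·P_B²), and H₂ := (1/√C)·(P_A⊗X_i − P_B⊗X_j). Then the exact second-order perturbation identity holds: (H_else + P_A⊗P_B) ⊗ Π₋ = (I_R⊗Π₋)·H₁·(I_R⊗Π₋) − (I_R⊗Π₋)·H₂·(I_R⊗G)·H₂·(I_R⊗Π₋). Equivalently, with the isometry T: |ψ⟩ ↦ |ψ⟩⊗|W_n⟩, one has ‖T(H_else + P_A⊗P_B)T† − (H₁)₋₋ + (H₂)₋₊ (H_{W++})^{−1} (H₂)₊₋‖ = 0. -/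

import Mathlib

open Matrix
open scoped Kronecker ComplexOrder

namespace QSim

/-- Index set for the computational basis of `n` qubits. -/
abbrev QIdx (n : ℕ) := Fin n → Fin 2

/-- Operators (matrices) on the Hilbert space of `n` qubits. -/
abbrev QOp (n : ℕ) := Matrix (QIdx n) (QIdx n) ℂ

/-- The operator (`ℓ²→ℓ²`) norm of a (possibly rectangular) matrix. -/
noncomputable def opNorm {I J : Type*} [Fintype I] [Fintype J] [DecidableEq J]
    (M : Matrix I J ℂ) : ℝ :=
  ‖LinearMap.toContinuousLinearMap (Matrix.toEuclideanLin M)‖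

/-- A two-qubit operator `E` placed on qubits `i` and `j` of an `n`-qubit register
(identity elsewhere), given entrywise. -/
def twoQubitOp (n : ℕ) (i j : Fin n) (E : Fin 2 → Fin 2 → Fin 2 → Fin 2 → ℂ) : QOp n :=
  fun x y => E (x i) (x j) (y i) (y j) * (if ∀ k, k ≠ i → k ≠ j → x k = y k then 1 else 0)

/-- A single-qubit operator `E` placed on qubit `i` of an `n`-qubit register. -/
def oneQubitOp (n : ℕ) (i : Fin n) (E : Matrix (Fin 2) (Fin 2) ℂ) : QOp n :=
  fun x y => E (x i) (y i) * (if ∀ k, k ≠ i → x k = y k then 1 else 0)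

/-- Sign used to build `(|01⟩ - |10⟩)/√2`. -/
def sgnE (a b : Fin 2) : ℂ :=
  if a = 0 ∧ b = 1 then 1 else if a = 1 ∧ b = 0 then -1 else 0

/-- Entries of the two-qubit projector `P` onto `span{(|01⟩-|10⟩)/√2, |11⟩}`:
`P = (1/2)(|01⟩-|10⟩)(⟨01|-⟨10|) + |11⟩⟨11|`. -/
noncomputable def Pentry (a b c d : Fin 2) : ℂ :=
  (1 / 2) * sgnE a b * sgnE c d + (if a = 1 ∧ b = 1 ∧ c = 1 ∧ d = 1 then 1 else 0)

/-- `H_{W,0} = Σ_{i=1}^{n-1} P_{i,i+1}`. -/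
noncomputable def HW0 (n : ℕ) : QOp n :=
  ∑ i : Fin (n - 1),
    twoQubitOp n ⟨i.1, by have := i.2; omega⟩ ⟨i.1 + 1, by have := i.2; omega⟩ Pentry

/-- The all-zeros state `|0…0⟩`. -/
def ket0 (n : ℕ) : QIdx n → ℂ := fun x => if ∀ k, x k = 0 then 1 else 0

/-- The generalized W state `|W_n⟩ = n^{-1/2} Σ_i |e_i⟩`. -/
noncomputable def Wstate (n : ℕ) : QIdx n → ℂ := fun x =>
  if (Finset.univ.filter fun k => x k = 1).card = 1 then (((Real.sqrt n)⁻¹ : ℝ) : ℂ) else 0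

end QSim

namespace QSim

/-- The Pauli `Z` matrix. -/
noncomputable def Zmat : Matrix (Fin 2) (Fin 2) ℂ := !![1, 0; 0, -1]

/-- The Pauli `X` matrix. -/
noncomputable def Xmat : Matrix (Fin 2) (Fin 2) ℂ := !![0, 1; 1, 0]

/-- The W-state parent Hamiltonian `H_W = Γ·H_{W,0} + 1 - Σ_{i=1}^n (1 - Z_i)/2`. -/
noncomputable def HWham (n : ℕ) (Γ : ℝ) : QOp n :=
  (Γ : ℂ) • HW0 n + 1 - ∑ i : Fin n, oneQubitOp n i ((1 - Zmat) / 2)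

end QSim

namespace QSim

/-- The rank-one projector `Π₋ = |W_n⟩⟨W_n|` (entries are real, so no conjugation is needed). -/
noncomputable def projW (n : ℕ) : QOp n := fun x y => Wstate n x * Wstate n y

/-- The Pauli `X` operator on qubit `i` of the chain. -/
noncomputable def Xop (n : ℕ) (i : Fin n) : QOp n := oneQubitOp n i Xmat

/-- The computational basis index with `1`s exactly in positions `a` and `i` (for `a ≠ i`),
i.e. the label of the basis state `|e_a ⊕ e_i⟩`. -/
def pairIdx (n : ℕ) (a i : Fin n) : QIdx n := fun k => if k = a ∨ k = i then 1 else 0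

/-- The expectation value `⟨W_n| M |W_n⟩`. -/
noncomputable def expectW (n : ℕ) (M : QOp n) : ℂ :=
  star (Wstate n) ⬝ᵥ (M *ᵥ Wstate n)

end QSim

namespace QSim

/-- The Hamming weight of a computational basis label. -/
def weight {n : ℕ} (x : QIdx n) : ℕ := (Finset.univ.filter fun k => x k = 1).card

lemma weight_comp_equiv {n : ℕ} (x : QIdx n) (σ : Equiv.Perm (Fin n)) :
    weight (x ∘ σ) = weight x := by
  unfold weight
  refine Finset.card_bij (fun k _ => σ k) ?_ ?_ ?_
  · intro k hk; simpa using hk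
  · intro a _ b _ h; exact σ.injective h
  · intro b hb; exact ⟨σ.symm b, by simpa using hb, by simp⟩

/-- The label `x` with its `i`-th bit flipped. -/
def flipBit {n : ℕ} (i : Fin n) (x : QIdx n) : QIdx n := Function.update x i (1 - x i)

lemma flipBit_of_ne {n : ℕ} {i k : Fin n} (h : k ≠ i) (x : QIdx n) : flipBit i x k = x k :=
  Function.update_of_ne h _ _

lemma weight_flipBit {n : ℕ} (i : Fin n) (x : QIdx n) :
    (x i = 1 ∧ weight (flipBit i x) + 1 = weight x) ∨
      (x i = 0 ∧ weight (flipBit i x) = weight x + 1) := by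
  have hx : x i = 0 ∨ x i = 1 := by
    generalize x i = a; fin_cases a <;> simp
  unfold weight
  rcases hx with hx | hx
  · right
    refine ⟨hx, ?_⟩
    rw [← Finset.card_insert_of_notMem (a := i) (by simp [hx])]
    congr 1
    ext k
    by_cases hk : k = i
    · subst hk; simp [flipBit, hx]
    · simp [flipBit_of_ne hk, hk]
  · left
    refine ⟨hx, ?_⟩
    rw [← Finset.card_erase_add_one (s := Finset.univ.filter fun k => x k = 1) (a := i)
      (by simp [hx])]
    congr 2
    ext k
    by_cases hk : k = i
    · subst hk; simp [flipBit, hx]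
    · simp [flipBit_of_ne hk, hk]

lemma weight_eq_zero_iff {n : ℕ} (x : QIdx n) : weight x = 0 ↔ x = 0 := by
  simp only [weight, Finset.card_eq_zero, Finset.filter_eq_empty_iff, funext_iff]
  refine ⟨fun h k => ?_, fun h k _ => by simp [h k]⟩
  have := @h k (Finset.mem_univ k)
  revert this
  generalize x k = a
  fin_cases a <;> simp

lemma ket0_eq_single (n : ℕ) : ket0 n = Pi.single 0 1 := by
  ext x
  simp [ket0, Pi.single_apply, funext_iff]

lemma Wstate_eq {n : ℕ} (x : QIdx n) :
    Wstate n x = if weight x = 1 then (((Real.sqrt n)⁻¹ : ℝ) : ℂ) else 0 := rfl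

lemma star_Wstate (n : ℕ) : star (Wstate n) = Wstate n := by
  ext x
  simp only [Pi.star_apply, Wstate_eq]
  split_ifs <;> simp

lemma card_weight_eq_one (n : ℕ) :
    (Finset.univ.filter fun x : QIdx n => weight x = 1).card = n := by
  conv_rhs => rw [← Fintype.card_fin n, ← Finset.card_univ]
  symm
  refine Finset.card_bij (fun k _ => (Pi.single k 1 : QIdx n)) ?_ ?_ ?_
  · intro k _
    rw [Finset.mem_filter, weight, Finset.card_eq_one]
    refine ⟨Finset.mem_univ _, k, ?_⟩
    ext l
    by_cases h : l = k <;> simp [h]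
  · intro a _ b _ h
    by_contra hab
    have := congrFun h a
    simp [hab] at this
  · intro x hx
    simp only [Finset.mem_filter, Finset.mem_univ, true_and, weight,
      Finset.card_eq_one] at hx
    obtain ⟨a, ha⟩ := hx
    refine ⟨a, Finset.mem_univ a, ?_⟩
    ext k
    have hk := Finset.ext_iff.1 ha k
    simp only [Finset.mem_filter, Finset.mem_univ, true_and, Finset.mem_singleton] at hk
    by_cases h : k = a
    · have := hk.2 h
      subst h
      simp [this]
    · have h1 : ¬ x k = 1 := fun e => h (hk.1 e)
      rw [Pi.single_eq_of_ne h]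
      revert h1
      generalize x k = c
      fin_cases c <;> simp

lemma Wstate_dotProduct_self {n : ℕ} (hn : n ≠ 0) : Wstate n ⬝ᵥ Wstate n = 1 := by
  have h : ∀ x : QIdx n, Wstate n x * Wstate n x = if weight x = 1 then (n : ℂ)⁻¹ else 0 := by
    intro x
    rw [Wstate_eq]
    split_ifs
    · rw [← Complex.ofReal_mul, ← mul_inv, Real.mul_self_sqrt (Nat.cast_nonneg n)]
      simp
    · simp
  simp only [dotProduct, h]
  rw [← Finset.sum_filter, Finset.sum_const, card_weight_eq_one]
  simp [hn]

lemma projW_eq_vecMulVec (n : ℕ) : projW n = vecMulVec (Wstate n) (Wstate n) := rfl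

lemma projW_mulVec (n : ℕ) (v : QIdx n → ℂ) :
    projW n *ᵥ v = (Wstate n ⬝ᵥ v) • Wstate n := by
  rw [projW_eq_vecMulVec, vecMulVec_mulVec]
  simp

lemma projW_mul_mul_projW (n : ℕ) (M : QOp n) :
    projW n * M * projW n = expectW n M • projW n := by
  simp only [projW_eq_vecMulVec, expectW, star_Wstate]
  rw [vecMulVec_mul, vecMulVec_mul_vecMulVec, dotProduct_mulVec]
  ext x y
  simp only [vecMulVec_apply, Matrix.smul_apply, Pi.smul_apply, smul_eq_mul]
  ring

lemma conjTranspose_oneQubitOp {n : ℕ} (i : Fin n) (E : Matrix (Fin 2) (Fin 2) ℂ) :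
    (oneQubitOp n i E)ᴴ = oneQubitOp n i Eᴴ := by
  ext x y
  simp only [oneQubitOp, conjTranspose_apply, star_mul']
  congr 1
  simp only [eq_comm]
  split_ifs <;> simp

lemma oneQubitOp_mulVec {n : ℕ} (i : Fin n) (E : Matrix (Fin 2) (Fin 2) ℂ)
    (v : QIdx n → ℂ) (x : QIdx n) :
    (oneQubitOp n i E *ᵥ v) x = ∑ c, E (x i) c * v (Function.update x i c) := by
  symm
  refine Finset.sum_of_injOn (fun c => Function.update x i c) ?_ (by simp) ?_ ?_
  · intro a _ b _ h
    simpa using congrFun h i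
  · intro y _ hy
    have : ¬ ∀ k, k ≠ i → x k = y k := by
      intro h
      refine hy ⟨y i, by simp, ?_⟩
      ext k
      by_cases hk : k = i
      · subst hk; simp
      · simp [hk, h k hk]
    simp [oneQubitOp, this]
  · intro c _
    have : ∀ k, k ≠ i → x k = Function.update x i c k := by
      intro k hk; simp [hk]
    simp only [oneQubitOp, Function.update_self, if_pos this, mul_one]

lemma oneQubitOp_commute {m : ℕ} {A B : Fin m} (hAB : A ≠ B) (E F : Matrix (Fin 2) (Fin 2) ℂ) :
    oneQubitOp m A E * oneQubitOp m B F = oneQubitOp m B F * oneQubitOp m A E := by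
  refine Matrix.toLin'.injective (LinearMap.ext fun v => ?_)
  simp only [toLin'_apply, ← mulVec_mulVec]
  ext x
  simp only [oneQubitOp_mulVec, Function.update_of_ne hAB, Function.update_of_ne hAB.symm,
    Finset.mul_sum]
  rw [Finset.sum_comm]
  refine Finset.sum_congr rfl fun c _ => Finset.sum_congr rfl fun d _ => ?_
  rw [Function.update_comm hAB]
  ring

lemma Xop_mulVec {n : ℕ} (i : Fin n) (v : QIdx n → ℂ) (x : QIdx n) :
    (Xop n i *ᵥ v) x = v (flipBit i x) := by
  rw [Xop, oneQubitOp_mulVec, flipBit]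
  generalize x i = a
  fin_cases a <;> simp [Xmat]

lemma conjTranspose_Xop {n : ℕ} (i : Fin n) : (Xop n i)ᴴ = Xop n i := by
  rw [Xop, conjTranspose_oneQubitOp]
  congr 1
  ext a b
  fin_cases a <;> fin_cases b <;> simp [Xmat]

lemma flipBit_flipBit {n : ℕ} (i : Fin n) (x : QIdx n) : flipBit i (flipBit i x) = x := by
  ext k
  simp [flipBit]

lemma Xop_mul_self {n : ℕ} (i : Fin n) : Xop n i * Xop n i = 1 := by
  refine Matrix.toLin'.injective (LinearMap.ext fun v => ?_)
  simp only [toLin'_apply, ← mulVec_mulVec, one_mulVec]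
  ext x
  simp only [Xop_mulVec, flipBit_flipBit]

lemma Xop_mulVec_Wstate {n : ℕ} (i : Fin n) (x : QIdx n) :
    (Xop n i *ᵥ Wstate n) x =
      (((Real.sqrt n)⁻¹ : ℝ) : ℂ) * ket0 n x + if weight x = 2 then Wstate n (flipBit i x) else 0 := by
  simp only [Xop_mulVec, ket0_eq_single, Pi.single_apply, ← weight_eq_zero_iff, Wstate_eq]
  rcases weight_flipBit i x with ⟨_, h⟩ | ⟨_, h⟩
  · have h0 : weight x ≠ 0 := by omega
    by_cases h1 : weight x = 2
    · simp [h1]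
    · have : weight (flipBit i x) ≠ 1 := by omega
      simp [h0, h1, this]
  · by_cases h1 : weight x = 0
    · simp [h, h1]
    · have : weight (flipBit i x) ≠ 1 := by omega
      simp [h1, this]

lemma HWham_eq (n : ℕ) (Γ : ℝ) :
    HWham n Γ = (Γ : ℂ) • HW0 n + 1 - diagonal fun x => (weight x : ℂ) := by
  have h2 : ((1 - Zmat) / 2 : Matrix (Fin 2) (Fin 2) ℂ) = !![0, 0; 0, 1] := by
    have : (2 : Matrix (Fin 2) (Fin 2) ℂ)⁻¹ = (1 / 2 : ℂ) • (1 : Matrix (Fin 2) (Fin 2) ℂ) := by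
      refine Matrix.inv_eq_right_inv ?_
      rw [mul_smul_comm, mul_one]
      ext a b
      fin_cases a <;> fin_cases b <;> simp [ofNat_apply]
    rw [div_eq_mul_inv, this, mul_smul_comm, mul_one]
    ext a b
    fin_cases a <;> fin_cases b <;> norm_num [Zmat]
  rw [HWham, h2]
  congr 1
  ext x y
  rw [Matrix.sum_apply]
  by_cases hxy : x = y
  · subst hxy
    simp only [oneQubitOp, diagonal_apply_eq, weight, Finset.card_filter, Nat.cast_sum]
    refine Finset.sum_congr rfl fun k _ => ?_
    generalize x k = a
    fin_cases a <;> simp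
  · rw [diagonal_apply_ne _ hxy]
    refine Finset.sum_eq_zero fun k _ => ?_
    by_cases h : ∀ l, l ≠ k → x l = y l
    · have : x k ≠ y k := fun e => hxy (funext fun l => by
        by_cases hl : l = k
        · rw [hl, e]
        · exact h l hl)
      simp only [oneQubitOp, if_pos h, mul_one]
      revert this
      generalize x k = a
      generalize y k = b
      fin_cases a <;> fin_cases b <;> simp
    · simp [oneQubitOp, h]

lemma Pentry_comm (a b c d : Fin 2) : star (Pentry c d a b) = Pentry a b c d := by
  fin_cases a <;> fin_cases b <;> fin_cases c <;> fin_cases d <;> simp [Pentry, sgnE]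

lemma conjTranspose_twoQubitOp_Pentry {n : ℕ} (i j : Fin n) :
    (twoQubitOp n i j Pentry)ᴴ = twoQubitOp n i j Pentry := by
  ext x y
  simp only [twoQubitOp, conjTranspose_apply, star_mul', Pentry_comm]
  congr 1
  simp only [eq_comm]
  split_ifs <;> simp

lemma twoQubitOp_Pentry_apply {n : ℕ} (i j : Fin n) (x y : QIdx n) :
    twoQubitOp n i j Pentry x y =
      (1 / 2) * ((if x = y then 1 else 0) - if x ∘ Equiv.swap i j = y then 1 else 0) +
        if x = y then (if x i = 1 ∧ x j = 1 then 1 else 0) else 0 := by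
  by_cases h : ∀ k, k ≠ i → k ≠ j → x k = y k
  · have h1 : x = y ↔ x i = y i ∧ x j = y j := by
      refine ⟨fun e => by simp [e], fun e => funext fun k => ?_⟩
      by_cases hi : k = i
      · rw [hi, e.1]
      by_cases hj : k = j
      · rw [hj, e.2]
      exact h k hi hj
    have h2 : x ∘ Equiv.swap i j = y ↔ x j = y i ∧ x i = y j := by
      refine ⟨fun e => by simp [← e], fun e => funext fun k => ?_⟩
      by_cases hi : k = i
      · simp [hi, e.1]
      by_cases hj : k = j
      · simp [hj, e.2]
      simpa [Equiv.swap_apply_of_ne_of_ne hi hj] using h k hi hj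
    simp only [twoQubitOp, if_pos h, h1, h2, mul_one]
    generalize x i = a
    generalize x j = b
    generalize y i = c
    generalize y j = d
    fin_cases a <;> fin_cases b <;> fin_cases c <;> fin_cases d <;> norm_num [Pentry, sgnE]
  · have h1 : x ≠ y := fun e => h (by simp [e])
    have h2 : x ∘ Equiv.swap i j ≠ y := fun e => h fun k hi hj => by
      simp [← e, Equiv.swap_apply_of_ne_of_ne hi hj]
    simp [twoQubitOp, h, h1, h2]

lemma twoQubitOp_Pentry_mulVec {n : ℕ} (i j : Fin n) (v : QIdx n → ℂ)
    (x : QIdx n) :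
    (twoQubitOp n i j Pentry *ᵥ v) x =
      (1 / 2) * (v x - v (x ∘ Equiv.swap i j)) + if x i = 1 ∧ x j = 1 then v x else 0 := by
  simp only [mulVec, dotProduct, twoQubitOp_Pentry_apply, add_mul, Finset.sum_add_distrib,
    mul_assoc, sub_mul, ← Finset.mul_sum, Finset.sum_sub_distrib, ite_mul, one_mul, zero_mul,
    Finset.sum_ite_eq, Finset.mem_univ, if_true]

lemma twoQubitOp_Pentry_mul_self {n : ℕ} (i j : Fin n) :
    twoQubitOp n i j Pentry * twoQubitOp n i j Pentry = twoQubitOp n i j Pentry := by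
  refine Matrix.toLin'.injective (LinearMap.ext fun v => ?_)
  simp only [toLin'_apply, ← mulVec_mulVec]
  ext x
  have hs : (x ∘ Equiv.swap i j) ∘ Equiv.swap i j = x := by
    ext k; simp
  simp only [twoQubitOp_Pentry_mulVec, hs]
  simp only [Function.comp_apply, Equiv.swap_apply_left, Equiv.swap_apply_right,
    and_comm (a := x j = 1)]
  split_ifs with h
  · have : x ∘ Equiv.swap i j = x := by
      ext k
      by_cases hi : k = i
      · simp [hi, h.1, h.2]
      by_cases hj : k = j
      · simp [hj, h.1, h.2]
      simp [Equiv.swap_apply_of_ne_of_ne hi hj]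
    rw [this]
    ring
  · ring

lemma star_dotProduct_twoQubitOp_Pentry {n : ℕ} (i j : Fin n)
    (v : QIdx n → ℂ) :
    star v ⬝ᵥ twoQubitOp n i j Pentry *ᵥ v =
      star (twoQubitOp n i j Pentry *ᵥ v) ⬝ᵥ twoQubitOp n i j Pentry *ᵥ v := by
  rw [star_mulVec, conjTranspose_twoQubitOp_Pentry, ← dotProduct_mulVec, mulVec_mulVec,
    twoQubitOp_Pentry_mul_self]

lemma isHermitian_HW0 (n : ℕ) : (HW0 n).IsHermitian := by
  simp only [IsHermitian, HW0, conjTranspose_sum, conjTranspose_twoQubitOp_Pentry]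

lemma HW0_mulVec_ket0 (n : ℕ) : HW0 n *ᵥ ket0 n = 0 := by
  rw [HW0, sum_mulVec]
  refine Finset.sum_eq_zero fun k _ => ?_
  ext x
  rw [twoQubitOp_Pentry_mulVec]
  simp only [ket0_eq_single, Pi.single_apply, ← weight_eq_zero_iff, weight_comp_equiv]
  split_ifs with h1 h2
  · rw [weight_eq_zero_iff] at h1
    simp [h1] at h2
  all_goals simp

lemma HW0_apply_of_weight_ne {n : ℕ} {x y : QIdx n} (h : weight x ≠ weight y) :
    HW0 n x y = 0 := by
  rw [HW0, Matrix.sum_apply]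
  refine Finset.sum_eq_zero fun k _ => ?_
  have h1 : x ≠ y := fun e => h (by rw [e])
  rw [twoQubitOp_Pentry_apply]
  have h2 : ∀ σ : Equiv.Perm (Fin n), x ∘ σ ≠ y := fun σ e =>
    h (by rw [← e, weight_comp_equiv])
  simp [h1, h2]

lemma HWham_mul_diagonal_weight (n : ℕ) (Γ : ℝ) :
    HWham n Γ * diagonal (fun x => (weight x : ℂ)) =
      diagonal (fun x => (weight x : ℂ)) * HWham n Γ := by
  have hK : HW0 n * diagonal (fun x => (weight x : ℂ)) =
      diagonal (fun x => (weight x : ℂ)) * HW0 n := by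
    ext x y
    rw [mul_diagonal, diagonal_mul]
    by_cases h : weight x = weight y
    · rw [h, mul_comm]
    · simp [HW0_apply_of_weight_ne h]
  rw [HWham_eq, sub_mul, mul_sub, add_mul, mul_add, smul_mul_assoc, mul_smul_comm, hK, one_mul,
    mul_one]

lemma eq_zero_of_swap_invariant {n : ℕ} {v : QIdx n → ℂ}
    (hadj : ∀ (a b : Fin n), a.1 + 1 = b.1 → ∀ x : QIdx n, x a = 1 → x b = 1 → v x = 0)
    (hswap : ∀ (a b : Fin n), a.1 + 1 = b.1 → ∀ x : QIdx n, v (x ∘ Equiv.swap a b) = v x)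
    (d : ℕ) : ∀ (a b : Fin n), a.1 + d + 1 = b.1 → ∀ x : QIdx n, x a = 1 → x b = 1 → v x = 0 := by
  induction d with
  | zero => simpa using hadj
  | succ d ih =>
    intro a b hab x ha hb
    let a' : Fin n := ⟨a.1 + 1, by omega⟩
    have hb' : Equiv.swap a a' b = b :=
      Equiv.swap_apply_of_ne_of_ne (by simp only [ne_eq, Fin.ext_iff]; omega)
        (by simp only [ne_eq, Fin.ext_iff, a']; omega)
    rw [← hswap a a' rfl x]
    exact ih a' b (by simp only [a']; omega) _ (by simp [ha]) (by simp [hb', hb])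

lemma eq_zero_of_HW0_mulVec_eq_zero {n : ℕ} {v : QIdx n → ℂ} (hv : HW0 n *ᵥ v = 0)
    {x : QIdx n} (hx : 2 ≤ weight x) : v x = 0 := by
  have hP : ∀ (a b : Fin n), a.1 + 1 = b.1 → twoQubitOp n a b Pentry *ᵥ v = 0 := by
    have h0 : star v ⬝ᵥ HW0 n *ᵥ v = 0 := by rw [hv, dotProduct_zero]
    rw [HW0, sum_mulVec, dotProduct_sum, Finset.sum_eq_zero_iff_of_nonneg] at h0
    · intro a b hab
      have := h0 ⟨a.1, by omega⟩ (Finset.mem_univ _)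
      rw [star_dotProduct_twoQubitOp_Pentry,
        dotProduct_star_self_eq_zero] at this
      convert this using 3
      exact Fin.ext hab.symm
    · intro k _
      rw [star_dotProduct_twoQubitOp_Pentry]
      exact dotProduct_star_self_nonneg _
  have hadj : ∀ (a b : Fin n), a.1 + 1 = b.1 → ∀ x : QIdx n, x a = 1 → x b = 1 →
      v x = 0 := by
    intro a b hab x ha hb
    have h := congrFun (hP a b hab) x
    have hs : x ∘ Equiv.swap a b = x := by
      ext k
      by_cases hi : k = a
      · simp [hi, ha, hb]
      by_cases hj : k = b
      · simp [hj, ha, hb]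
      simp [Equiv.swap_apply_of_ne_of_ne hi hj]
    rw [twoQubitOp_Pentry_mulVec, hs, if_pos ⟨ha, hb⟩] at h
    simpa using h
  have hswap : ∀ (a b : Fin n), a.1 + 1 = b.1 → ∀ x : QIdx n,
      v (x ∘ Equiv.swap a b) = v x := by
    intro a b hab x
    have h := congrFun (hP a b hab) x
    rw [twoQubitOp_Pentry_mulVec] at h
    split_ifs at h with h1
    · rw [hadj a b hab x h1.1 h1.2,
        hadj a b hab _ (by simpa using h1.2) (by simpa using h1.1)]
    · simp only [one_div, add_zero, Pi.zero_apply, mul_eq_zero, inv_eq_zero,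
        OfNat.ofNat_ne_zero, false_or] at h
      exact (sub_eq_zero.1 h).symm
  obtain ⟨a, b, ha, hb, hab⟩ := Finset.one_lt_card_iff.1 hx
  simp only [Finset.mem_filter, Finset.mem_univ, true_and] at ha hb
  rcases lt_or_gt_of_ne hab with h | h
  · exact eq_zero_of_swap_invariant hadj hswap (b.1 - a.1 - 1) a b
      (by have : a.1 < b.1 := h; omega) x ha hb
  · exact eq_zero_of_swap_invariant hadj hswap (a.1 - b.1 - 1) b a
      (by have : b.1 < a.1 := h; omega) x hb ha

lemma mul_normSq_le_of_orthogonal_ker {ι : Type*} [Fintype ι] [DecidableEq ι]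
    {K : Matrix ι ι ℂ} (hK : K.IsHermitian) {lam : ℝ}
    (hlam : ∀ μ : ℝ, (μ : ℂ) ∈ spectrum ℂ K → μ ≠ 0 → lam ≤ μ) {g : ι → ℂ}
    (hg : ∀ φ : ι → ℂ, K *ᵥ φ = 0 → star φ ⬝ᵥ g = 0) :
    lam * (star g ⬝ᵥ g).re ≤ (star g ⬝ᵥ K *ᵥ g).re := by
  set U : Matrix ι ι ℂ := (hK.eigenvectorUnitary : Matrix ι ι ℂ) with hU
  set c : ι → ℂ := Uᴴ *ᵥ g with hc
  have hUU : U * Uᴴ = 1 := Unitary.coe_mul_star_self hK.eigenvectorUnitary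
  have hKU : K = U * diagonal (fun k => (hK.eigenvalues k : ℂ)) * Uᴴ := by
    have := hK.spectral_theorem
    rw [Unitary.conjStarAlgAut_apply] at this
    exact this
  have hsc : star c = star g ᵥ* U := by rw [hc, star_mulVec, conjTranspose_conjTranspose]
  have h1 : star g ⬝ᵥ g = star c ⬝ᵥ c := by
    rw [hsc, hc, ← dotProduct_mulVec, mulVec_mulVec, hUU, one_mulVec]
  have h2 : star g ⬝ᵥ K *ᵥ g = star c ⬝ᵥ diagonal (fun k => (hK.eigenvalues k : ℂ)) *ᵥ c := by
    conv_lhs => rw [hKU]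
    rw [hsc, hc, ← dotProduct_mulVec, mulVec_mulVec, mulVec_mulVec, mul_assoc]
  have hck : ∀ k, hK.eigenvalues k = 0 → c k = 0 := by
    intro k hk
    have := hg (hK.eigenvectorBasis k) (by rw [hK.mulVec_eigenvectorBasis, hk, zero_smul])
    rw [← this]
    rfl
  rw [h1, h2]
  simp only [dotProduct, Complex.re_sum, Finset.mul_sum, mulVec_diagonal]
  refine Finset.sum_le_sum fun k _ => ?_
  by_cases hk : hK.eigenvalues k = 0
  · simp [hck k hk]
  · have hle : lam ≤ hK.eigenvalues k := by
      refine hlam _ ?_ hk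
      have := hK.eigenvalues_mem_spectrum_real k
      rwa [← spectrum.algebraMap_mem_iff ℂ] at this
    have h3 : (star c k * c k).re = Complex.normSq (c k) := by
      simp [Complex.normSq_apply]
    have h4 : (star c k * ((hK.eigenvalues k : ℂ) * c k)).re =
        hK.eigenvalues k * Complex.normSq (c k) := by
      simp [Complex.normSq_apply]; ring
    rw [h3, h4]
    exact mul_le_mul_of_nonneg_right hle (Complex.normSq_nonneg _)

section WInverse

variable {n : ℕ} {Γ : ℝ} {G : QOp n}

lemma diagonal_weight_mulVec_Wstate (n : ℕ) :
    diagonal (fun x => (weight x : ℂ)) *ᵥ Wstate n = Wstate n := by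
  ext x
  rw [mulVec_diagonal, Wstate_eq]
  split_ifs with h <;> simp [h]

lemma diagonal_weight_commute_of_inverse (hG_herm : Gᴴ = G)
    (hG_left : G * HWham n Γ = 1 - projW n) (hG_right : HWham n Γ * G = 1 - projW n)
    (hG_W : G *ᵥ Wstate n = 0) :
    G * diagonal (fun x => (weight x : ℂ)) = diagonal (fun x => (weight x : ℂ)) * G := by
  set N : QOp n := diagonal (fun x => (weight x : ℂ)) with hN
  have hNW : N * projW n = projW n := by
    rw [projW_eq_vecMulVec, mul_vecMulVec, diagonal_weight_mulVec_Wstate]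
  have hWN : projW n * N = projW n := by
    have hW : Wstate n ᵥ* N = Wstate n := by
      rw [← mulVec_transpose, hN, diagonal_transpose, diagonal_weight_mulVec_Wstate]
    rw [projW_eq_vecMulVec, vecMulVec_mul, hW]
  have hGP : G * projW n = 0 := by
    rw [projW_eq_vecMulVec, mul_vecMulVec, hG_W, zero_vecMulVec]
  have hPG : projW n * G = 0 := by
    have hW : Wstate n ᵥ* G = 0 := by
      have := congrArg star hG_W
      rwa [star_mulVec, hG_herm, star_Wstate, star_zero] at this
    rw [projW_eq_vecMulVec, vecMulVec_mul, hW, vecMulVec_zero]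
  calc G * N = G * N * (HWham n Γ * G + projW n) := by rw [hG_right]; simp
    _ = G * (N * HWham n Γ) * G + G * (N * projW n) := by noncomm_ring
    _ = (G * HWham n Γ) * N * G + G * projW n := by
      rw [← HWham_mul_diagonal_weight, hNW]; noncomm_ring
    _ = N * G - projW n * N * G := by rw [hG_left, hGP]; noncomm_ring
    _ = N * G := by rw [hWN, hPG, sub_zero]

lemma inverse_mulVec_ket0 (hG_left : G * HWham n Γ = 1 - projW n) :
    G *ᵥ ket0 n = ket0 n := by
  have h0 : HWham n Γ *ᵥ ket0 n = ket0 n := by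
    rw [HWham_eq, sub_mulVec, add_mulVec, smul_mulVec, HW0_mulVec_ket0, one_mulVec]
    ext x
    simp only [smul_zero, zero_add, Pi.sub_apply, mulVec_diagonal, ket0_eq_single,
      Pi.single_apply, ← weight_eq_zero_iff]
    split_ifs with h <;> simp [h]
  have hW : Wstate n ⬝ᵥ ket0 n = 0 := by
    have : weight (0 : QIdx n) = 0 := (weight_eq_zero_iff _).2 rfl
    simp [ket0_eq_single, Wstate_eq, this]
  conv_lhs => rw [← h0, mulVec_mulVec, hG_left, sub_mulVec, one_mulVec, projW_mulVec, hW]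
  simp

lemma inverse_quadraticForm_bounds {lam : ℝ}
    (hlam_min : ∀ μ : ℝ, (μ : ℂ) ∈ spectrum ℂ (HW0 n) → μ ≠ 0 → lam ≤ μ)
    (hΓ : 0 ≤ Γ) (hc : 0 < Γ * lam - 1) (hG_herm : Gᴴ = G)
    (hG_left : G * HWham n Γ = 1 - projW n) (hG_right : HWham n Γ * G = 1 - projW n)
    (hG_W : G *ᵥ Wstate n = 0) {v : QIdx n → ℂ} (hv : ∀ x, weight x ≠ 2 → v x = 0) :
    0 ≤ (star v ⬝ᵥ G *ᵥ v).re ∧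
      (Γ * lam - 1) * (star v ⬝ᵥ G *ᵥ v).re ≤ (star v ⬝ᵥ v).re := by
  set g := G *ᵥ v with hg
  have hNv : diagonal (fun x => (weight x : ℂ)) *ᵥ v = (2 : ℂ) • v := by
    ext x
    rw [mulVec_diagonal, Pi.smul_apply, smul_eq_mul]
    by_cases h : weight x = 2
    · simp [h]
    · simp [hv x h]
  have hNg : diagonal (fun x => (weight x : ℂ)) *ᵥ g = (2 : ℂ) • g := by
    rw [hg, mulVec_mulVec,
      ← diagonal_weight_commute_of_inverse hG_herm hG_left hG_right hG_W, ← mulVec_mulVec, hNv,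
      mulVec_smul]
  have hg2 : ∀ x, weight x ≠ 2 → g x = 0 := by
    intro x hx
    have h := congrFun hNg x
    rw [mulVec_diagonal, Pi.smul_apply, smul_eq_mul, ← sub_eq_zero, ← sub_mul] at h
    refine (mul_eq_zero.1 h).resolve_left fun e => hx ?_
    exact_mod_cast sub_eq_zero.1 e
  have hWv : Wstate n ⬝ᵥ v = 0 := by
    refine Finset.sum_eq_zero fun x _ => ?_
    by_cases h : weight x = 2
    · simp [Wstate_eq, h]
    · simp [hv x h]
  have hHg : HWham n Γ *ᵥ g = v := by
    rw [hg, mulVec_mulVec, hG_right, sub_mulVec, one_mulVec, projW_mulVec, hWv, zero_smul,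
      sub_zero]
  have hKg : (Γ : ℂ) • (HW0 n *ᵥ g) - g = v := by
    rw [← hHg, HWham_eq, sub_mulVec, add_mulVec, smul_mulVec, one_mulVec, hNg, two_smul]
    abel
  have hgap : lam * (star g ⬝ᵥ g).re ≤ (star g ⬝ᵥ HW0 n *ᵥ g).re := by
    refine mul_normSq_le_of_orthogonal_ker (isHermitian_HW0 n) hlam_min fun φ hφ => ?_
    refine Finset.sum_eq_zero fun x _ => ?_
    by_cases h : weight x = 2
    · simp [eq_zero_of_HW0_mulVec_eq_zero hφ h.ge]
    · simp [hg2 x h]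
  have hsymm : star v ⬝ᵥ g = star g ⬝ᵥ v := by
    rw [hg, star_mulVec, hG_herm, dotProduct_mulVec]
  have hgv : (star g ⬝ᵥ v).re = Γ * (star g ⬝ᵥ HW0 n *ᵥ g).re - (star g ⬝ᵥ g).re := by
    conv_lhs => rw [← hKg]
    simp [dotProduct_sub, dotProduct_smul]
  have hgg : 0 ≤ (star g ⬝ᵥ g).re := (Complex.le_def.1 (dotProduct_star_self_nonneg g)).1
  have hlow : (Γ * lam - 1) * (star g ⬝ᵥ g).re ≤ (star g ⬝ᵥ v).re := by
    rw [hgv]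
    nlinarith [mul_le_mul_of_nonneg_left hgap hΓ]
  rw [hsymm]
  refine ⟨(mul_nonneg hc.le hgg).trans hlow, ?_⟩
  have hsq : 0 ≤ (star (v - ((Γ * lam - 1 : ℝ) : ℂ) • g) ⬝ᵥ
      (v - ((Γ * lam - 1 : ℝ) : ℂ) • g)).re :=
    (Complex.le_def.1 (dotProduct_star_self_nonneg _)).1
  generalize Γ * lam - 1 = c at *
  have hexp : (star (v - (c : ℂ) • g) ⬝ᵥ (v - (c : ℂ) • g)).re =
      (star v ⬝ᵥ v).re - 2 * c * (star g ⬝ᵥ v).re + c * (c * (star g ⬝ᵥ g).re) := by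
    simp only [star_sub, star_smul, sub_dotProduct, dotProduct_sub, smul_dotProduct,
      dotProduct_smul, hsymm, Complex.star_def, Complex.conj_ofReal, Complex.sub_re, smul_eq_mul,
      Complex.re_ofReal_mul]
    ring
  rw [hexp] at hsq
  nlinarith [mul_le_mul_of_nonneg_left hlow hc.le]

lemma expectW_Xop_mul_mul_Xop (M : QOp n) (i j : Fin n) :
    expectW n (Xop n i * M * Xop n j) =
      star (Xop n i *ᵥ Wstate n) ⬝ᵥ M *ᵥ (Xop n j *ᵥ Wstate n) := by
  rw [expectW, star_mulVec, conjTranspose_Xop, ← dotProduct_mulVec, mulVec_mulVec, mulVec_mulVec]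

lemma star_Xop_Wstate_dotProduct_self (hn : n ≠ 0) (i : Fin n) :
    star (Xop n i *ᵥ Wstate n) ⬝ᵥ (Xop n i *ᵥ Wstate n) = 1 := by
  rw [star_mulVec, conjTranspose_Xop, ← dotProduct_mulVec, mulVec_mulVec, Xop_mul_self,
    one_mulVec, star_Wstate, Wstate_dotProduct_self hn]

lemma expectW_Xop_add_ne_zero (hn : 2 ≤ n) (i j : Fin n) {lam : ℝ} (hlam_pos : 0 < lam)
    (hlam_min : ∀ μ : ℝ, (μ : ℂ) ∈ spectrum ℂ (HW0 n) → μ ≠ 0 → lam ≤ μ)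
    (hΓ : 5 * (n : ℝ) < Γ * lam + 1) (hG_herm : Gᴴ = G)
    (hG_left : G * HWham n Γ = 1 - projW n) (hG_right : HWham n Γ * G = 1 - projW n)
    (hG_W : G *ᵥ Wstate n = 0) :
    expectW n (Xop n i * G * Xop n j) + expectW n (Xop n j * G * Xop n i) ≠ 0 := by
  have hn' : (2 : ℝ) ≤ n := by exact_mod_cast hn
  have hn0 : n ≠ 0 := by omega
  have hc : (5 * n - 2 : ℝ) < Γ * lam - 1 := by linarith
  have hcpos : 0 < Γ * lam - 1 := by linarith
  have hΓ0 : 0 ≤ Γ := by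
    by_contra! h
    nlinarith
  have hbound := fun v hv => inverse_quadraticForm_bounds (v := v) hlam_min hΓ0 hcpos hG_herm
    hG_left hG_right hG_W hv
  rw [expectW_Xop_mul_mul_Xop, expectW_Xop_mul_mul_Xop]
  set a := Xop n i *ᵥ Wstate n with ha
  set b := Xop n j *ᵥ Wstate n with hb
  set r : ℝ := (Real.sqrt n)⁻¹ with hr
  set s : QIdx n → ℂ := a + b - ((2 * r : ℝ) : ℂ) • ket0 n with hs
  have hs2 : ∀ x, weight x ≠ 2 → s x = 0 := by
    intro x hx
    simp only [hs, ha, hb, Pi.sub_apply, Pi.add_apply, Pi.smul_apply, smul_eq_mul,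
      Xop_mulVec_Wstate, if_neg hx, hr]
    push_cast
    ring
  have hd2 : ∀ x, weight x ≠ 2 → (a - b) x = 0 := by
    intro x hx
    simp only [ha, hb, Pi.sub_apply, Xop_mulVec_Wstate, if_neg hx]
    ring
  have hsum : (star (a + b) ⬝ᵥ G *ᵥ (a + b)).re = 4 / n + (star s ⬝ᵥ G *ᵥ s).re := by
    have h1 : a + b = ((2 * r : ℝ) : ℂ) • ket0 n + s := by rw [hs]; abel
    have h00 : star (ket0 n) ⬝ᵥ ket0 n = 1 := by simp [ket0_eq_single]
    have hs0 : s 0 = 0 := hs2 0 (by rw [(weight_eq_zero_iff _).2 rfl]; norm_num)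
    have h0s : star (ket0 n) ⬝ᵥ G *ᵥ s = 0 := by
      have h := star_mulVec G (ket0 n)
      rw [inverse_mulVec_ket0 hG_left, hG_herm] at h
      rw [dotProduct_mulVec, ← h]
      simp [ket0_eq_single, hs0]
    have hs0' : star s ⬝ᵥ ket0 n = 0 := by simp [ket0_eq_single, hs0]
    have hr2 : 2 * r * (2 * r) = 4 / n := by
      have : r * r = (n : ℝ)⁻¹ := by
        rw [hr, ← mul_inv, Real.mul_self_sqrt (Nat.cast_nonneg n)]
      rw [div_eq_mul_inv, ← this]
      ring
    rw [h1, mulVec_add, mulVec_smul, inverse_mulVec_ket0 hG_left]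
    simp only [star_add, star_smul, add_dotProduct, dotProduct_add, smul_dotProduct,
      dotProduct_smul, h00, h0s, hs0', Complex.star_def, Complex.conj_ofReal, smul_eq_mul,
      mul_zero, mul_one, add_zero, zero_add, Complex.add_re, ← Complex.ofReal_mul,
      Complex.ofReal_re, hr2]
  have hpar : (star (a + b) ⬝ᵥ (a + b)).re + (star (a - b) ⬝ᵥ (a - b)).re = 4 := by
    have h1 : star a ⬝ᵥ a = 1 := star_Xop_Wstate_dotProduct_self hn0 i
    have h2 : star b ⬝ᵥ b = 1 := star_Xop_Wstate_dotProduct_self hn0 j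
    simp only [star_sub, star_add, sub_dotProduct, dotProduct_sub, add_dotProduct,
      dotProduct_add, h1, h2, Complex.sub_re, Complex.add_re, Complex.one_re]
    ring
  have hab : 0 ≤ (star (a + b) ⬝ᵥ (a + b)).re :=
    (Complex.le_def.1 (dotProduct_star_self_nonneg _)).1
  have hpol : 2 * (star a ⬝ᵥ G *ᵥ b + star b ⬝ᵥ G *ᵥ a) =
      star (a + b) ⬝ᵥ G *ᵥ (a + b) - star (a - b) ⬝ᵥ G *ᵥ (a - b) := by
    simp only [star_sub, star_add, sub_dotProduct, dotProduct_sub, add_dotProduct,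
      dotProduct_add, mulVec_add, mulVec_sub]
    ring
  intro hzero
  rw [hzero, mul_zero] at hpol
  have hre := congrArg Complex.re hpol
  rw [Complex.zero_re, Complex.sub_re, hsum] at hre
  obtain ⟨hs_nonneg, -⟩ := hbound s hs2
  obtain ⟨-, hd_le⟩ := hbound (a - b) hd2
  have hge : 4 / (n : ℝ) ≤ (star (a - b) ⬝ᵥ G *ᵥ (a - b)).re := by linarith
  have h4 : (Γ * lam - 1) * (4 / n) ≤ 4 :=
    (mul_le_mul_of_nonneg_left hge hcpos.le).trans (hd_le.trans (by linarith))
  rw [← mul_div_assoc, div_le_iff₀ (by linarith)] at h4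
  linarith

end WInverse

/-- The exact second-order perturbation identity behind the long-range gadget:
`(H_else + P_A⊗P_B) ⊗ Π₋ = (1⊗Π₋)H₁(1⊗Π₋) − (1⊗Π₋)H₂(1⊗G)H₂(1⊗Π₋)`, where
`H₁ = H_else + (1/C)(d_i P_A² + d_j P_B²)` (acting on the register, extended by the identity)
and `H₂ = (1/√C)(P_A⊗X_i − P_B⊗X_j)`. -/
theorem long_range_second_order_identity
    (m : ℕ) (A B : Fin m) (hAB : A ≠ B)
    (Helse : QOp m) (hHelse : Helseᴴ = Helse)
    (pA pB : Matrix (Fin 2) (Fin 2) ℂ) (hpA : pAᴴ = pA) (hpB : pBᴴ = pB)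
    (n : ℕ) (hn : 2 ≤ n) (i j : Fin n) (hij : i ≠ j)
    (lam : ℝ) (hlam_pos : 0 < lam)
    (hlam_mem : (lam : ℂ) ∈ spectrum ℂ (HW0 n))
    (hlam_min : ∀ μ : ℝ, (μ : ℂ) ∈ spectrum ℂ (HW0 n) → μ ≠ 0 → lam ≤ μ)
    (Γ : ℝ) (hΓ : 5 * (n : ℝ) < Γ * lam + 1)
    (G : QOp n) (hG_herm : Gᴴ = G)
    (hG_left : G * HWham n Γ = 1 - projW n) (hG_right : HWham n Γ * G = 1 - projW n)
    (hG_W : G *ᵥ Wstate n = 0) :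
    let PA : QOp m := oneQubitOp m A pA
    let PB : QOp m := oneQubitOp m B pB
    let di : ℂ := expectW n (Xop n i * G * Xop n i)
    let dj : ℂ := expectW n (Xop n j * G * Xop n j)
    let C : ℂ := expectW n (Xop n i * G * Xop n j) + expectW n (Xop n j * G * Xop n i)
    let H₁ : QOp m := Helse + C⁻¹ • (di • (PA * PA) + dj • (PB * PB))
    let H₂ : Matrix (QIdx m × QIdx n) (QIdx m × QIdx n) ℂ :=
      (C ^ ((1 : ℂ) / 2))⁻¹ • (PA ⊗ₖ Xop n i - PB ⊗ₖ Xop n j)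
    (Helse + PA * PB) ⊗ₖ projW n
      = ((1 : QOp m) ⊗ₖ projW n) * (H₁ ⊗ₖ (1 : QOp n)) * ((1 : QOp m) ⊗ₖ projW n)
        - ((1 : QOp m) ⊗ₖ projW n) * H₂ * ((1 : QOp m) ⊗ₖ G) * H₂
            * ((1 : QOp m) ⊗ₖ projW n) := by
  intro PA PB di dj C H₁ H₂
  have hC : C ≠ 0 :=
    expectW_Xop_add_ne_zero hn i j hlam_pos hlam_min hΓ hG_herm hG_left hG_right hG_W
  have hcomm : PB * PA = PA * PB := oneQubitOp_commute hAB.symm pB pA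
  have hsqrt : (C ^ ((1 : ℂ) / 2))⁻¹ * (C ^ ((1 : ℂ) / 2))⁻¹ = C⁻¹ := by
    rw [← mul_inv, ← Complex.cpow_add _ _ hC]
    norm_num
  have hW2 : projW n * projW n = projW n := by
    rw [projW_eq_vecMulVec, vecMulVec_mul_vecMulVec, Wstate_dotProduct_self (by omega), one_smul]
  have hcompress : ∀ (k l : Fin n), projW n * Xop n k * G * Xop n l * projW n =
      expectW n (Xop n k * G * Xop n l) • projW n := fun k l => by
    rw [← projW_mul_mul_projW]
    simp only [Matrix.mul_assoc]
  have hfirst : ((1 : QOp m) ⊗ₖ projW n) * (H₁ ⊗ₖ (1 : QOp n)) * ((1 : QOp m) ⊗ₖ projW n) =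
      H₁ ⊗ₖ projW n := by
    simp only [← mul_kronecker_mul, Matrix.one_mul, Matrix.mul_one, hW2]
  have hexpand : ((1 : QOp m) ⊗ₖ projW n) * (PA ⊗ₖ Xop n i - PB ⊗ₖ Xop n j) *
      ((1 : QOp m) ⊗ₖ G) * (PA ⊗ₖ Xop n i - PB ⊗ₖ Xop n j) * ((1 : QOp m) ⊗ₖ projW n) =
      (di • (PA * PA) + dj • (PB * PB) - C • (PA * PB)) ⊗ₖ projW n := by
    simp only [Matrix.mul_sub, Matrix.sub_mul, ← mul_kronecker_mul, Matrix.one_mul,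
      Matrix.mul_one, hcompress, hcomm]
    ext ⟨x, x'⟩ ⟨y, y'⟩
    simp only [Matrix.sub_apply, Matrix.add_apply, Matrix.smul_apply, kroneckerMap_apply,
      smul_eq_mul, di, dj, C]
    ring
  have hsecond : ((1 : QOp m) ⊗ₖ projW n) * H₂ * ((1 : QOp m) ⊗ₖ G) * H₂ *
      ((1 : QOp m) ⊗ₖ projW n) =
      (C⁻¹ • (di • (PA * PA) + dj • (PB * PB)) - PA * PB) ⊗ₖ projW n := by
    simp only [H₂, Matrix.mul_smul, Matrix.smul_mul, smul_smul, hsqrt, hexpand]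
    rw [← smul_kronecker, smul_sub, smul_smul C⁻¹ C, inv_mul_cancel₀ hC, one_smul]
  rw [hfirst, hsecond]
  ext ⟨x, x'⟩ ⟨y, y'⟩
  simp only [H₁, Matrix.sub_apply, Matrix.add_apply, kroneckerMap_apply]
  ring

end QSim
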